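/- For every u ∈ X, Σ_{t=1}^T ( ℓ_t(x_t) − ℓ_t(u) ) ≤ Σ_{t=1}^T (8/(μ·t))·‖g_t − p_t(x_t)‖² + Σ_{t=2}^T (4/(μ·t))·‖p_t(x_{t-1}) − p_{t-1}(x_{t-1})‖² + (4L²D²/μ)·log( 1 + 16·L/μ ) + G·D, where log denotes the natural logarithm. -/

import Mathlib

open Finset RealInnerProductSpace

/-- A minimizer over a convex set of a function which is `m`-strongly convex along segments
satisfies the quadratic growth condition. -/
lemma quadratic_growth_of_minimizer {E : Type*} [NormedAddCommGroup E] [InnerProductSpace ℝ E]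
    {X : Set E} (hX : Convex ℝ X) {h : E → ℝ} {m : ℝ} {a y : E} (ha : a ∈ X) (hy : y ∈ X)
    (hmin : ∀ z ∈ X, h a ≤ h z)
    (hconv : ∀ c : ℝ, h (a + c • (y - a)) ≤
      (1 - c) * h a + c * h y - m / 2 * (c * (1 - c)) * ‖y - a‖ ^ 2) :
    h a + m / 2 * ‖y - a‖ ^ 2 ≤ h y := by
  set K := m / 2 * ‖y - a‖ ^ 2 with hK
  have key : ∀ c : ℝ, 0 < c → c ≤ 1 → h a + (1 - c) * K ≤ h y := by
    intro c hc hc1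
    have h1 := hmin _ (hX.add_smul_sub_mem ha hy ⟨hc.le, hc1⟩)
    have h2 := hconv c
    have h3 : c * (h a + (1 - c) * K) ≤ c * h y := by rw [hK]; linarith
    exact le_of_mul_le_mul_left h3 hc
  have hlim : Filter.Tendsto (fun c : ℝ => h a + (1 - c) * K) (nhdsWithin 0 (Set.Ioi 0))
      (nhds (h a + (1 - 0) * K)) :=
    (Continuous.tendsto (by fun_prop) 0).mono_left nhdsWithin_le_nhds
  have hle := le_of_tendsto hlim (b := h y) (by
    filter_upwards [Ioc_mem_nhdsGT (zero_lt_one (α := ℝ))] with c hc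
    exact key c hc.1 hc.2)
  simpa using hle

/-- The exact convexity defect of a linear function plus a quadratic one. -/
lemma linear_add_quadratic_segment {E : Type*} [NormedAddCommGroup E] [InnerProductSpace ℝ E]
    (μ : ℝ) (v w a y : E) (c : ℝ) :
    ⟪v, a + c • (y - a) - w⟫ + μ / 2 * ‖a + c • (y - a) - w‖ ^ 2 =
      (1 - c) * (⟪v, a - w⟫ + μ / 2 * ‖a - w‖ ^ 2) + c * (⟪v, y - w⟫ + μ / 2 * ‖y - w‖ ^ 2) -
        μ / 2 * (c * (1 - c)) * ‖y - a‖ ^ 2 := by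
  have h1 : a + c • (y - a) - w = (a - w) + c • ((y - w) - (a - w)) := by simp [add_sub_right_comm]
  have h2 : y - a = (y - w) - (a - w) := by simp
  rw [h1, h2]
  generalize a - w = p
  generalize y - w = q
  rw [norm_add_sq_real, norm_smul, mul_pow, norm_sub_sq_real, inner_add_right, real_inner_smul_right,
    real_inner_smul_right, inner_sub_right, inner_sub_right, real_inner_self_eq_norm_sq,
    Real.norm_eq_abs, sq_abs, real_inner_comm p q]
  ring

/-- Increment of `log (min n (1 + b))` absorbing the part of the harmonic series below `b`. -/
lemma log_min_step {n : ℕ} (hn : 1 ≤ n) {b : ℝ} (hb : 0 ≤ b) :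
    Real.log (min (n : ℝ) (1 + b)) ≤ Real.log (min ((n + 1 : ℕ) : ℝ) (1 + b)) ∧
    ((n : ℝ) < b → Real.log (min (n : ℝ) (1 + b)) + 1 / ((n : ℝ) + 1) ≤
      Real.log (min ((n + 1 : ℕ) : ℝ) (1 + b))) := by
  have hn' : (1 : ℝ) ≤ n := by exact_mod_cast hn
  refine ⟨Real.log_le_log (lt_min (by linarith) (by linarith))
    (min_le_min_right _ (by push_cast; linarith)), fun h => ?_⟩
  rw [min_eq_left (by linarith), min_eq_left (by push_cast; linarith)]
  have h1 := Real.one_sub_inv_le_log_of_pos (x := ((n : ℝ) + 1) / n) (by positivity)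
  rw [Real.log_div (by positivity) (by positivity)] at h1
  have h2 : 1 - (((n : ℝ) + 1) / n)⁻¹ = 1 / ((n : ℝ) + 1) := by
    field_simp
    ring
  push_cast
  linarith

/-- The squared movement left over at time `n` is paid for by the strong convexity at time `n`,
up to the increment of a logarithm. -/
lemma movement_le_log_increment {D μ L d : ℝ} (hμ : 0 < μ) (hL : 0 ≤ L) (hd : 0 ≤ d) (hdD : d ≤ D)
    {n : ℕ} (hn : 1 ≤ n) :
    4 * L ^ 2 / (μ * ((n : ℝ) + 1)) * d ^ 2 - μ * n / 4 * d ^ 2 ≤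
      4 * L ^ 2 * D ^ 2 / μ * (Real.log (min ((n + 1 : ℕ) : ℝ) (1 + 4 * L / μ)) -
        Real.log (min (n : ℝ) (1 + 4 * L / μ))) := by
  have hn' : (1 : ℝ) ≤ n := by exact_mod_cast hn
  obtain ⟨h1, h2⟩ := log_min_step hn (b := 4 * L / μ) (by positivity)
  have hA : 0 ≤ 4 * L ^ 2 * D ^ 2 / μ := by positivity
  rcases lt_or_ge (n : ℝ) (4 * L / μ) with h | h
  · have h3 := mul_le_mul_of_nonneg_left (le_sub_iff_add_le'.mpr (h2 h)) hA
    have h4 : 4 * L ^ 2 / (μ * ((n : ℝ) + 1)) * d ^ 2 ≤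
        4 * L ^ 2 * D ^ 2 / μ * (1 / ((n : ℝ) + 1)) := by
      calc _ ≤ 4 * L ^ 2 / (μ * ((n : ℝ) + 1)) * D ^ 2 := by gcongr
        _ = _ := by field_simp
    have h5 : 0 ≤ μ * n / 4 * d ^ 2 := by positivity
    linarith
  · have h3 := mul_nonneg hA (sub_nonneg.mpr h1)
    rw [div_le_iff₀ hμ] at h
    have h4 : 4 * L ^ 2 / (μ * ((n : ℝ) + 1)) ≤ μ * n / 4 := by
      rw [div_le_iff₀ (by positivity)]
      have h6 : (4 * L) ^ 2 ≤ (n * μ) ^ 2 := by gcongr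
      have h7 : 0 ≤ (n : ℝ) * μ ^ 2 := by positivity
      nlinarith
    have h5 := mul_le_mul_of_nonneg_right h4 (sq_nonneg d)
    linarith

/-- Young's inequality for a gradient difference split into four parts. -/
lemma mul_le_four_squares {a d e₁ e₂ v w k : ℝ} (hk : 0 < k) (ha : 0 ≤ a)
    (h : a ≤ e₁ + e₂ + v + w) :
    a * d ≤ 4 / k * e₁ ^ 2 + 4 / k * e₂ ^ 2 + 4 / k * v ^ 2 + 4 / k * w ^ 2 + k / 4 * d ^ 2 := by
  have h1 : a ^ 2 ≤ 4 * (e₁ ^ 2 + e₂ ^ 2 + v ^ 2 + w ^ 2) := by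
    have : a ^ 2 ≤ (e₁ + e₂ + v + w) ^ 2 := by gcongr
    nlinarith [sq_nonneg (e₁ - e₂), sq_nonneg (e₁ - v), sq_nonneg (e₁ - w), sq_nonneg (e₂ - v),
      sq_nonneg (e₂ - w), sq_nonneg (v - w)]
  have h2 : a * d ≤ a ^ 2 / k + k / 4 * d ^ 2 := by
    have : a ^ 2 / k + k / 4 * d ^ 2 - a * d = (a - k / 2 * d) ^ 2 / k := by field_simp; ring
    have : 0 ≤ (a - k / 2 * d) ^ 2 / k := by positivity
    linarith
  have h3 : a ^ 2 / k ≤ 4 * (e₁ ^ 2 + e₂ ^ 2 + v ^ 2 + w ^ 2) / k := by gcongr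
  have h4 : 4 * (e₁ ^ 2 + e₂ ^ 2 + v ^ 2 + w ^ 2) / k =
      4 / k * e₁ ^ 2 + 4 / k * e₂ ^ 2 + 4 / k * v ^ 2 + 4 / k * w ^ 2 := by ring
  linarith

/-- OFTL on surrogate losses: regret bound with the movement terms summed up. -/
theorem stmt_8 {E : Type*} [NormedAddCommGroup E] [InnerProductSpace ℝ E]
    (D G μ L : ℝ) (hD : 0 < D) (hG : 0 < G) (hμ : 0 < μ) (hL : 0 ≤ L)
    (X : Set E) (hXne : X.Nonempty) (hXconv : Convex ℝ X)
    (hXdiam : ∀ x ∈ X, ∀ y ∈ X, ‖x - y‖ ≤ D)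
    (T : ℕ) (hT : 1 ≤ T)
    (g : ℕ → E) (hg : ∀ t ∈ Finset.Icc 1 T, ‖g t‖ ≤ G)
    (x : ℕ → E) (hxX : ∀ t ∈ Finset.Icc 1 (T + 1), x t ∈ X)
    (ℓ : ℕ → E → ℝ)
    (hℓ : ∀ t ∈ Finset.Icc 1 T, ∀ y : E,
      ℓ t y = ⟪g t, y - x t⟫ + μ / 2 * ‖y - x t‖ ^ 2)
    (hxmin : ∀ t ∈ Finset.Icc 2 T, ∀ y ∈ X,
      ∑ s ∈ Finset.Icc 1 (t - 1), ℓ s (x t) + ⟪g (t - 1), x t⟫ ≤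
        ∑ s ∈ Finset.Icc 1 (t - 1), ℓ s y + ⟪g (t - 1), y⟫)
    (hxlast : ∀ y ∈ X,
      ∑ s ∈ Finset.Icc 1 T, ℓ s (x (T + 1)) ≤ ∑ s ∈ Finset.Icc 1 T, ℓ s y)
    (p : ℕ → E → E)
    (hp : ∀ t ∈ Finset.Icc 1 T, ∀ a ∈ X, ∀ b ∈ X, ‖p t a - p t b‖ ≤ L * ‖a - b‖)
    (u : E) (hu : u ∈ X) :
    ∑ t ∈ Finset.Icc 1 T, (ℓ t (x t) - ℓ t u) ≤
      ∑ t ∈ Finset.Icc 1 T, 8 / (μ * (t : ℝ)) * ‖g t - p t (x t)‖ ^ 2 +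
        ∑ t ∈ Finset.Icc 2 T,
          4 / (μ * (t : ℝ)) * ‖p t (x (t - 1)) - p (t - 1) (x (t - 1))‖ ^ 2 +
        4 * L ^ 2 * D ^ 2 / μ * Real.log (1 + 16 * L / μ) +
        G * D := by
  have hstep : ∀ n, 1 ≤ n → n + 1 ≤ T → ∀ y ∈ X,
      ∑ s ∈ Icc 1 n, ℓ s (x (n + 1)) + ⟪g n, x (n + 1)⟫ + μ * n / 2 * ‖y - x (n + 1)‖ ^ 2 ≤
        ∑ s ∈ Icc 1 n, ℓ s y + ⟪g n, y⟫ := by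
    intro n hn hnT y hy
    refine quadratic_growth_of_minimizer (h := fun z => ∑ s ∈ Icc 1 n, ℓ s z + ⟪g n, z⟫) hXconv
      (hxX _ (by simp; omega)) hy
      (by simpa using hxmin (n + 1) (by simp; omega)) fun c => le_of_eq ?_
    have hsum : ∑ s ∈ Icc 1 n, ℓ s (x (n + 1) + c • (y - x (n + 1))) =
        ∑ s ∈ Icc 1 n, ((1 - c) * ℓ s (x (n + 1)) + c * ℓ s y -
          μ / 2 * (c * (1 - c)) * ‖y - x (n + 1)‖ ^ 2) := by
      refine sum_congr rfl fun s hs => ?_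
      have hs' : s ∈ Icc 1 T := by simp at hs ⊢; omega
      simp only [hℓ s hs']
      exact linear_add_quadratic_segment ..
    simp only [hsum, sum_sub_distrib, sum_add_distrib, ← mul_sum, sum_const, Nat.card_Icc,
      nsmul_eq_mul, inner_add_right, real_inner_smul_right, inner_sub_right, Nat.add_sub_cancel]
    ring
  have hmain : ∀ n, 1 ≤ n → n ≤ T →
      -∑ s ∈ Icc 1 n, ℓ s (x (n + 1)) ≤
        ∑ t ∈ Icc 1 n, 8 / (μ * (t : ℝ)) * ‖g t - p t (x t)‖ ^ 2 +
        ∑ t ∈ Icc 2 n, 4 / (μ * (t : ℝ)) * ‖p t (x (t - 1)) - p (t - 1) (x (t - 1))‖ ^ 2 +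
        4 * L ^ 2 * D ^ 2 / μ * Real.log (min (n : ℝ) (1 + 4 * L / μ)) + G * D
        - 4 / (μ * n) * ‖g n - p n (x n)‖ ^ 2 - μ * n / 4 * ‖x (n + 1) - x n‖ ^ 2 := by
    intro n hn
    induction n, hn using Nat.le_induction with
    | base =>
      intro _
      have h1 : (1 : ℕ) ∈ Icc 1 T := by simp; omega
      have hb : 0 ≤ 4 * L / μ := by positivity
      have hin : -⟪g 1, x (1 + 1) - x 1⟫ ≤ G * D := by
        refine (neg_le_abs _).trans ((abs_real_inner_le_norm _ _).trans ?_)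
        exact mul_le_mul (hg 1 h1) (hXdiam _ (hxX _ (by simp; omega)) _ (hxX _ (by simp)))
          (norm_nonneg _) hG.le
      have h8 : 8 / (μ * 1) * ‖g 1 - p 1 (x 1)‖ ^ 2 =
          4 / (μ * 1) * ‖g 1 - p 1 (x 1)‖ ^ 2 + 4 / (μ * 1) * ‖g 1 - p 1 (x 1)‖ ^ 2 := by ring
      have h4 : 0 ≤ 4 / (μ * 1) * ‖g 1 - p 1 (x 1)‖ ^ 2 := by positivity
      have hd : 0 ≤ μ * ‖x (1 + 1) - x 1‖ ^ 2 := by positivity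
      simp only [Icc_self, sum_singleton, hℓ 1 h1, Nat.cast_one,
        min_eq_left (le_add_of_nonneg_right hb), Real.log_one, Icc_eq_empty (by norm_num : ¬ 2 ≤ 1), sum_empty]
      linarith
    | succ n hn ih =>
      intro hnT
      have ih := ih (by omega)
      have hX1 : x (n + 1) ∈ X := hxX _ (by simp; omega)
      have hX0 : x n ∈ X := hxX _ (by simp; omega)
      have hX2 : x (n + 1 + 1) ∈ X := hxX _ (by simp; omega)
      have hn1 : n + 1 ∈ Icc 1 T := by simp; omega
      have hn' : (1 : ℝ) ≤ n := by exact_mod_cast hn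
      have hopt := hstep n hn hnT _ hX2
      have hmov := movement_le_log_increment hμ hL (norm_nonneg (x (n + 1) - x n))
        (hXdiam _ hX1 _ hX0) hn
      have htri : ‖g (n + 1) - g n‖ ≤ ‖g (n + 1) - p (n + 1) (x (n + 1))‖ + ‖g n - p n (x n)‖ +
          ‖p (n + 1) (x n) - p n (x n)‖ + L * ‖x (n + 1) - x n‖ := by
        have hlip := hp (n + 1) hn1 _ hX1 _ hX0
        have heq : g (n + 1) - g n = (g (n + 1) - p (n + 1) (x (n + 1))) - (g n - p n (x n)) +
          (p (n + 1) (x n) - p n (x n)) + (p (n + 1) (x (n + 1)) - p (n + 1) (x n)) := by abel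
        rw [heq]
        refine (norm_add_le _ _).trans (add_le_add ((norm_add_le _ _).trans ?_) hlip)
        gcongr
        exact norm_sub_le _ _
      have hyoung := mul_le_four_squares (d := ‖x (n + 1 + 1) - x (n + 1)‖)
        (k := μ * ((n : ℝ) + 1)) (by positivity) (norm_nonneg _) htri
      have hin : -⟪g (n + 1) - g n, x (n + 1 + 1) - x (n + 1)⟫ ≤ _ :=
        (neg_le_abs _).trans (abs_real_inner_le_norm _ _)
      have hε : 4 / (μ * ((n : ℝ) + 1)) * ‖g n - p n (x n)‖ ^ 2 ≤
          4 / (μ * n) * ‖g n - p n (x n)‖ ^ 2 := by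
        gcongr
        linarith
      have h8 : 8 / (μ * ((n : ℝ) + 1)) * ‖g (n + 1) - p (n + 1) (x (n + 1))‖ ^ 2 =
          2 * (4 / (μ * ((n : ℝ) + 1)) * ‖g (n + 1) - p (n + 1) (x (n + 1))‖ ^ 2) := by ring
      have hw : 4 / (μ * ((n : ℝ) + 1)) * (L * ‖x (n + 1) - x n‖) ^ 2 =
          4 * L ^ 2 / (μ * ((n : ℝ) + 1)) * ‖x (n + 1) - x n‖ ^ 2 := by ring
      rw [sum_Icc_succ_top (by omega), sum_Icc_succ_top (by omega), sum_Icc_succ_top (by omega),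
        hℓ _ hn1]
      simp only [inner_sub_left, inner_sub_right, Nat.add_sub_cancel] at *
      push_cast at *
      linarith
  have hself : ∀ t ∈ Icc 1 T, ℓ t (x t) = 0 := fun t ht => by simp [hℓ t ht]
  rw [sum_sub_distrib, sum_eq_zero hself]
  have hT' : (1 : ℝ) ≤ T := by exact_mod_cast hT
  have hlog : Real.log (min (T : ℝ) (1 + 4 * L / μ)) ≤ Real.log (1 + 16 * L / μ) := by
    have hb : 0 ≤ 4 * L / μ := by positivity
    refine Real.log_le_log (lt_min (by linarith) (by linarith)) ((min_le_right _ _).trans ?_)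
    gcongr
    norm_num
  have hlog' := mul_le_mul_of_nonneg_left hlog
    (by positivity : 0 ≤ 4 * L ^ 2 * D ^ 2 / μ)
  have h1 : 0 ≤ 4 / (μ * T) * ‖g T - p T (x T)‖ ^ 2 := by positivity
  have h2 : 0 ≤ μ * T / 4 * ‖x (T + 1) - x T‖ ^ 2 := by positivity
  linarith [hmain T hT le_rfl, hxlast u hu]
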